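/- For any m ≥ 2, n ≥ 2, and any real number α, the contract function Π^α defined by Π^α_i(P; j) = s_qu(p_i; j) − (m−1)² s_qu(p̄_{−i}; j) + α p̄_{−i,j} is strictly proper. -/

import Mathlib

open Finset

/-- Brier's quadratic scoring rule: `s_qu(p; j) = 1 - (1 - p j)^2 - ∑_{l ≠ j} (p l)^2`. -/
noncomputable def squ {n : ℕ} (p : Fin n → ℝ) (j : Fin n) : ℝ :=
  1 - (1 - p j) ^ 2 - ∑ l ∈ ({j}ᶜ : Finset (Fin n)), (p l) ^ 2

/-- The average report `p̄_{-i}` of all experts except `i`. -/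
noncomputable def avgExcept {m n : ℕ} (P : Fin m → Fin n → ℝ) (i : Fin m) : Fin n → ℝ :=
  fun j => (1 / ((m : ℝ) - 1)) * ∑ k ∈ ({i}ᶜ : Finset (Fin m)), P k j

/-- The contract function `Π^α_i(P; j) = s_qu(p_i; j) - (m-1)^2 s_qu(p̄_{-i}; j) + α p̄_{-i,j}`. -/
noncomputable def piAlpha {m n : ℕ} (α : ℝ) (P : Fin m → Fin n → ℝ) (i : Fin m) (j : Fin n) : ℝ :=
  squ (P i) j - ((m : ℝ) - 1) ^ 2 * squ (avgExcept P i) j + α * avgExcept P i j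

/-- A tuple of reports, one probability distribution in the simplex `Δ_n` per expert. -/
def IsSimplexTuple {m n : ℕ} (P : Fin m → Fin n → ℝ) : Prop :=
  ∀ k, P k ∈ stdSimplex ℝ (Fin n)

/-- A contract function is strictly proper if, for every expert `i`, belief `b ∈ Δ_n`, and
fixed reports of the other experts, the expected reward `∑ j, b j * Π_i(x, p_{-i}; j)` is
uniquely maximized over `x ∈ Δ_n` at `x = b`. -/
def StrictlyProper {m n : ℕ} (Φ : (Fin m → Fin n → ℝ) → Fin m → Fin n → ℝ) : Prop :=
  ∀ (i : Fin m) (P : Fin m → Fin n → ℝ), IsSimplexTuple P →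
    ∀ b ∈ stdSimplex ℝ (Fin n), ∀ x ∈ stdSimplex ℝ (Fin n), x ≠ b →
      ∑ j, b j * Φ (Function.update P i x) i j < ∑ j, b j * Φ (Function.update P i b) i j

theorem squ_eq {n : ℕ} (p : Fin n → ℝ) (j : Fin n) : squ p j = 2 * p j - ∑ l, p l ^ 2 := by
  rw [squ, ← Finset.sum_add_sum_compl {j} fun l => p l ^ 2, Finset.sum_singleton]
  ring

/-- The expected Brier score of `x` under `b` falls short of that of `b` by the squared
Euclidean distance. -/
theorem sum_mul_squ_add_sum_sq {n : ℕ} (b x : Fin n → ℝ) (hb : ∑ j, b j = 1) :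
    ∑ j, b j * squ x j + ∑ j, (x j - b j) ^ 2 = ∑ j, b j ^ 2 := by
  simp only [squ_eq, mul_sub, Finset.sum_sub_distrib, ← Finset.sum_mul, hb, one_mul]
  rw [sub_add_eq_add_sub, ← Finset.sum_add_distrib, ← Finset.sum_sub_distrib]
  exact Finset.sum_congr rfl fun j _ => by ring

theorem sum_mul_squ_lt {n : ℕ} {b x : Fin n → ℝ} (hb : ∑ j, b j = 1) (hx : x ≠ b) :
    ∑ j, b j * squ x j < ∑ j, b j * squ b j := by
  have hpos : 0 < ∑ j, (x j - b j) ^ 2 := by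
    obtain ⟨j, hj⟩ := Function.ne_iff.mp hx
    exact Finset.sum_pos' (fun _ _ => sq_nonneg _)
      ⟨j, Finset.mem_univ j, sq_pos_of_ne_zero (sub_ne_zero.mpr hj)⟩
  have h₁ := sum_mul_squ_add_sum_sq b x hb
  have h₂ := sum_mul_squ_add_sum_sq b b hb
  simp only [sub_self, ne_eq, OfNat.ofNat_ne_zero, not_false_eq_true, zero_pow,
    Finset.sum_const_zero, add_zero] at h₂
  linarith

theorem avgExcept_update {m n : ℕ} (P : Fin m → Fin n → ℝ) (i : Fin m) (x : Fin n → ℝ) :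
    avgExcept (Function.update P i x) i = avgExcept P i := by
  funext j
  unfold avgExcept
  congr 1
  refine Finset.sum_congr rfl fun k hk => ?_
  rw [Function.update_of_ne (by simpa using hk)]

/-- For any `m ≥ 2`, `n ≥ 2`, and any real `α`, the contract function `Π^α` is
strictly proper. -/
theorem piAlpha_strictlyProper (m n : ℕ) (hm : 2 ≤ m) (hn : 2 ≤ n) (α : ℝ) :
    StrictlyProper (piAlpha (m := m) (n := n) α) := by
  intro i P _ b hb x _ hxb
  simp only [piAlpha, avgExcept_update, Function.update_self, mul_add, mul_sub,
    Finset.sum_add_distrib, Finset.sum_sub_distrib]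
  linarith [sum_mul_squ_lt hb.2 hxb]
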